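/- ∫₀¹ (1-x)/(1-x⁶)·log⁴(x) dx = (32√3·π⁵ + 16335·ζ(5))/1458. -/

import Mathlib

open MeasureTheory Filter Topology Set

lemma aux_tend (j : ℕ) : Tendsto (fun x : ℝ => x * Real.log x ^ j) (𝓝[>] 0) (𝓝 0) := by
  rcases Nat.eq_zero_or_pos j with rfl | hj
  · simp only [pow_zero, mul_one]
    exact tendsto_nhdsWithin_of_tendsto_nhds tendsto_id
  · have hj0 : (j : ℝ) ≠ 0 := by positivity
    have h := (tendsto_log_mul_rpow_nhdsGT_zero (r := 1 / (j:ℝ)) (by positivity)).pow j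
    rw [zero_pow hj.ne'] at h
    refine h.congr' ?_
    filter_upwards [self_mem_nhdsWithin] with x hx
    have hx : 0 < x := hx
    rw [mul_pow, ← Real.rpow_natCast (x ^ (1 / (j:ℝ))), ← Real.rpow_mul hx.le,
      one_div_mul_cancel hj0, Real.rpow_one, mul_comm]

lemma aux_cont (m j : ℕ) : ContinuousOn (fun x : ℝ => x ^ (m + 1) * Real.log x ^ j) (Icc 0 1) := by
  intro x hx
  rcases hx.1.eq_or_lt with rfl | h
  · have : ContinuousWithinAt (fun x : ℝ => x ^ (m + 1) * Real.log x ^ j) (Ioi 0) 0 := by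
      have h1 : Tendsto (fun x : ℝ => x ^ m) (𝓝[>] 0) (𝓝 (0 ^ m)) :=
        tendsto_nhdsWithin_of_tendsto_nhds ((continuous_pow m).tendsto 0)
      have := h1.mul (aux_tend j)
      unfold ContinuousWithinAt
      simp only [mul_zero] at this
      simp only [ne_eq, Nat.add_eq_zero_iff, one_ne_zero, and_false, not_false_eq_true, zero_pow,
        zero_mul]
      refine this.congr fun x => by ring
    exact (continuousWithinAt_Ioi_iff_Ici.1 this).mono Icc_subset_Ici_self
  · exact (((continuous_pow _).continuousAt).mul
      ((Real.continuousAt_log h.ne').pow j)).continuousWithinAt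

noncomputable def auxF (m : ℕ) (x : ℝ) : ℝ :=
  x ^ (m + 1) * Real.log x ^ 4 * (1 / ((m:ℝ) + 1)) - x ^ (m + 1) * Real.log x ^ 3 * (4 / ((m:ℝ) + 1) ^ 2)
   + x ^ (m + 1) * Real.log x ^ 2 * (12 / ((m:ℝ) + 1) ^ 3)
   - x ^ (m + 1) * Real.log x ^ 1 * (24 / ((m:ℝ) + 1) ^ 4)
   + x ^ (m + 1) * Real.log x ^ 0 * (24 / ((m:ℝ) + 1) ^ 5)

lemma auxF_cont (m : ℕ) : ContinuousOn (auxF m) (Icc 0 1) := by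
  unfold auxF
  exact (((((aux_cont m 4).mul continuousOn_const).sub ((aux_cont m 3).mul continuousOn_const)).add
    ((aux_cont m 2).mul continuousOn_const)).sub ((aux_cont m 1).mul continuousOn_const)).add
    ((aux_cont m 0).mul continuousOn_const)

lemma auxF_deriv (m : ℕ) (x : ℝ) (hx : 0 < x) :
    HasDerivAt (auxF m) (x ^ m * Real.log x ^ 4) x := by
  have hp : HasDerivAt (fun x : ℝ => x ^ (m + 1)) (((m + 1 : ℕ) : ℝ) * x ^ m) x := by
    simpa using hasDerivAt_pow (m + 1) x
  have hl := fun j : ℕ => hp.mul ((Real.hasDerivAt_log hx.ne').pow j)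
  have h := ((((((hl 4).mul_const (1 / ((m:ℝ) + 1))).sub ((hl 3).mul_const (4 / ((m:ℝ) + 1) ^ 2))).add
    ((hl 2).mul_const (12 / ((m:ℝ) + 1) ^ 3))).sub ((hl 1).mul_const (24 / ((m:ℝ) + 1) ^ 4))).add
    ((hl 0).mul_const (24 / ((m:ℝ) + 1) ^ 5)))
  refine HasDerivAt.congr_deriv h ?_
  have : (m:ℝ) + 1 ≠ 0 := by positivity
  simp
  field_simp
  ring

lemma aux_int (m : ℕ) : IntervalIntegrable (fun x : ℝ => x ^ m * Real.log x ^ 4) volume 0 1 := by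
  refine intervalIntegral.intervalIntegrable_deriv_of_nonneg (g := auxF m) ?_ ?_ ?_
  · simpa using auxF_cont m
  · intro x hx
    simp at hx
    exact auxF_deriv m x hx.1
  · intro x hx
    simp at hx
    have := hx.1
    positivity

lemma aux_val (m : ℕ) : ∫ x in (0:ℝ)..1, x ^ m * Real.log x ^ 4 = 24 / ((m:ℝ) + 1) ^ 5 := by
  rw [intervalIntegral.integral_eq_sub_of_hasDerivAt_of_le zero_le_one (auxF_cont m)
    (fun x hx => auxF_deriv m x hx.1) (aux_int m)]
  simp [auxF]

lemma aux_summ : Summable (fun n : ℕ => 1 / (n:ℝ) ^ 5) :=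
  Real.summable_one_div_nat_pow.2 (by norm_num)

lemma aux_summ' (r : ℕ) : Summable (fun n : ℕ => 1 / (6 * (n:ℝ) + r) ^ 5) := by
  have hi : Function.Injective (fun n : ℕ => 6 * n + r) := fun a b h => by
    simp at h; exact h
  have := aux_summ.comp_injective hi
  refine this.congr fun n => ?_
  simp [Function.comp]

lemma aux_integral : ∫ x in (0:ℝ)..1, (1 - x) / (1 - x ^ 6) * Real.log x ^ 4 =
    24 * ((∑' n : ℕ, 1 / (6 * (n:ℝ) + (1:ℕ)) ^ 5) - ∑' n : ℕ, 1 / (6 * (n:ℝ) + (2:ℕ)) ^ 5) := by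
  set F : ℕ → ℝ → ℝ := fun n x => x ^ (6 * n) * Real.log x ^ 4 - x ^ (6 * n + 1) * Real.log x ^ 4
    with hF
  have hFint : ∀ n, IntegrableOn (F n) (Ioc 0 1) := fun n =>
    ((intervalIntegrable_iff_integrableOn_Ioc_of_le zero_le_one).1
      ((aux_int (6 * n)).sub (aux_int (6 * n + 1))))
  have hval : ∀ n, ∫ x in Ioc (0:ℝ) 1, F n x =
      24 * (1 / (6 * (n:ℝ) + (1:ℕ)) ^ 5 - 1 / (6 * (n:ℝ) + (2:ℕ)) ^ 5) := fun n => by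
    rw [← intervalIntegral.integral_of_le zero_le_one]
    simp only [hF]
    rw [intervalIntegral.integral_sub (aux_int (6 * n)) (aux_int (6 * n + 1)), aux_val, aux_val]
    push_cast
    rw [add_assoc (6 * (n:ℝ)) 1 1]
    norm_num
    ring
  have hnorm : ∀ n, ∫ x in Ioc (0:ℝ) 1, ‖F n x‖ = ∫ x in Ioc (0:ℝ) 1, F n x := fun n => by
    refine setIntegral_congr_fun measurableSet_Ioc fun x hx => ?_
    refine Real.norm_of_nonneg ?_
    have h0 := hx.1
    have h1 := hx.2
    have : F n x = x ^ (6 * n) * (1 - x) * Real.log x ^ 4 := by simp only [hF]; ring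
    rw [this]
    have : 0 ≤ 1 - x := by linarith
    positivity
  have hs := ((aux_summ' 1).sub (aux_summ' 2)).mul_left 24
  have h := hasSum_integral_of_summable_integral_norm (μ := volume.restrict (Ioc (0:ℝ) 1)) hFint
    (by simp only [hnorm, hval]; exact hs)
  simp only [hval] at h
  have h2 := (((aux_summ' 1).hasSum.sub (aux_summ' 2).hasSum).mul_left 24)
  rw [← h.unique h2, intervalIntegral.integral_of_le zero_le_one, integral_Ioc_eq_integral_Ioo,
    integral_Ioc_eq_integral_Ioo]
  refine setIntegral_congr_fun measurableSet_Ioo fun x hx => ?_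
  have h6 : x ^ 6 < 1 := pow_lt_one₀ hx.1.le hx.2 (by norm_num)
  have hg := (hasSum_geometric_of_lt_one (pow_nonneg hx.1.le 6) h6).mul_left
    ((1 - x) * Real.log x ^ 4)
  have : HasSum (fun n => F n x) ((1 - x) * Real.log x ^ 4 * (1 - x ^ 6)⁻¹) := by
    refine hg.congr_fun ?_
    intro n
    simp only [hF]
    ring
  simp only [this.tsum_eq]
  ring

lemma aux_bern : (Polynomial.map (algebraMap ℚ ℝ) (Polynomial.bernoulli 5)).eval (1/3 : ℝ)
    = -5 / 243 := by
  have h5 : bernoulli' 5 = 0 := by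
    rw [bernoulli'_def]
    norm_num [Finset.sum_range_succ, Nat.choose]
  rw [Polynomial.bernoulli]
  simp [Finset.sum_range_succ, Polynomial.eval_add, Polynomial.map_add,
    bernoulli_eq_bernoulli'_of_ne_one, h5, bernoulli_one, Nat.choose]
  norm_num

lemma aux_sin : HasSum (fun n : ℕ => 1 / (n : ℝ) ^ 5 * Real.sin (2 * Real.pi * n * (1/3)))
    (2 * Real.pi ^ 5 / 729) := by
  have h := hasSum_one_div_nat_pow_mul_sin (k := 2) (by norm_num) (x := 1/3)
    ⟨by norm_num, by norm_num⟩
  rw [show 2 * 2 + 1 = 5 from rfl, aux_bern, show Nat.factorial 5 = 120 from rfl] at h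
  convert h using 1
  push_cast
  ring

lemma aux_mult (m r : ℕ) (hm : 0 < m) (hr : r < m) (g : ℕ → ℝ) (a : ℝ)
    (h : HasSum (fun n => g (m * n + r)) a) :
    HasSum (fun n => if n % m = r then g n else 0) a := by
  have hi : Function.Injective (fun n : ℕ => m * n + r) := fun a b h => by
    simp at h; omega
  rw [← hi.hasSum_iff]
  · convert h using 1
    ext n
    simp [Nat.mod_eq_of_lt hr]
  · intro x hx
    rw [if_neg]
    intro h
    exact hx ⟨x / m, by rw [← h]; exact Nat.div_add_mod x m⟩

lemma aux_sinval (n : ℕ) : Real.sin (2 * Real.pi * n * (1/3)) =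
    √3 / 2 * (if n % 3 = 1 then 1 else if n % 3 = 2 then -1 else 0) := by
  have hn : (n:ℝ) = 3 * (n / 3 : ℕ) + (n % 3 : ℕ) := by exact_mod_cast (Nat.div_add_mod n 3).symm
  have e : 2 * Real.pi * n * (1/3) = 2 * Real.pi / 3 * (n % 3 : ℕ) + (n / 3 : ℕ) * (2 * Real.pi) := by
    rw [hn]
    ring
  rw [e, Real.sin_add_nat_mul_two_pi]
  have : n % 3 < 3 := Nat.mod_lt _ (by norm_num)
  interval_cases n % 3
  · simp
  · rw [show 2 * Real.pi / 3 * (1:ℕ) = Real.pi - Real.pi / 3 by push_cast; ring, Real.sin_pi_sub]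
    simp
  · rw [show 2 * Real.pi / 3 * (2:ℕ) = Real.pi / 3 + Real.pi by push_cast; ring, Real.sin_add_pi]
    simp

lemma aux_main : (∑' n : ℕ, 1 / (6 * (n:ℝ) + (1:ℕ)) ^ 5) - ∑' n : ℕ, 1 / (6 * (n:ℝ) + (2:ℕ)) ^ 5
    = (1 - 2 / 32 - 1 / 243 + 2 / 7776) / 2 * (∑' k : ℕ, 1 / ((k : ℝ) + 1) ^ 5)
      + √3 / 3 * (2 * Real.pi ^ 5 / 729) := by
  set Z := ∑' k : ℕ, 1 / ((k : ℝ) + 1) ^ 5 with hZ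
  have hz : HasSum (fun n : ℕ => 1 / (n:ℝ) ^ 5) Z := by
    have := aux_summ.hasSum
    rwa [aux_summ.tsum_eq_zero_add, Nat.cast_zero, zero_pow (by norm_num), div_zero, zero_add,
      show (∑' b : ℕ, 1 / ((b + 1 : ℕ) : ℝ) ^ 5) = Z by simp [hZ]] at this
  have hm : ∀ m : ℕ, 0 < m → HasSum (fun n : ℕ => if n % m = 0 then 1 / (n:ℝ) ^ 5 else 0)
      (1 / (m:ℝ) ^ 5 * Z) := fun m hm0 => by
    refine aux_mult m 0 hm0 hm0 (fun n => 1 / (n:ℝ) ^ 5) _ ?_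
    refine (hz.mul_left (1 / (m:ℝ) ^ 5)).congr_fun fun n => ?_
    push_cast
    rw [add_zero, mul_pow]
    ring
  have h1 := aux_mult 6 1 (by norm_num) (by norm_num) (fun n => 1 / (n:ℝ) ^ 5) _
    (by simpa using (aux_summ' 1).hasSum)
  have h2 := aux_mult 6 2 (by norm_num) (by norm_num) (fun n => 1 / (n:ℝ) ^ 5) _
    (by simpa using (aux_summ' 2).hasSum)
  have h3 := ((((hz.sub ((hm 2 (by norm_num)).mul_left 2)).sub (hm 3 (by norm_num))).add
    ((hm 6 (by norm_num)).mul_left 2)).mul_left (1/2)).add (aux_sin.mul_left (√3 / 3))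
  have h4 := h1.sub h2
  have := h4.unique (h3.congr_fun fun n => ?_)
  · simp only [one_div] at this ⊢
    push_cast at this ⊢
    rw [this]
    ring
  · rw [aux_sinval]
    have h33 : √3 * √3 = 3 := Real.mul_self_sqrt (by norm_num)
    have e : ∀ t c : ℝ, √3 / 3 * (t * (√3 / 2 * c)) = t * c / 2 := fun t c => by
      linear_combination (t * c / 6) * h33
    rw [e]
    have a2 : n % 2 = (n % 6) % 2 := by omega
    have a3 : n % 3 = (n % 6) % 3 := by omega
    rw [a2, a3]
    have : n % 6 < 6 := Nat.mod_lt _ (by norm_num)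
    generalize 1 / (n:ℝ) ^ 5 = t
    interval_cases n % 6 <;> norm_num <;> ring

theorem stmt16 :
    ∫ x in (0:ℝ)..1, (1 - x) / (1 - x ^ 6) * Real.log x ^ 4 =
      (32 * Real.sqrt 3 * Real.pi ^ 5 + 16335 * ∑' k : ℕ, 1 / ((k : ℝ) + 1) ^ 5) / 1458 := by
  rw [aux_integral, aux_main]
  ring
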